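/- Fix integers k ≥ 3 and l ≥ 0, and set p1 = l·F(2k−1)² + F(2k−3)², q1 = l·F(2k+1)² + F(2k−1)² + 2, p2 = F(2k−1), q2 = l·F(2k−1) + F(2k−5), and d = F(2k+1)·p1. Let Γ be the additive submonoid of ℕ generated by g0 = p1·p2, g1 = q1·p2, g2 = p1·p2·q1 + q2, and let R(n) = #(Γ ∩ [0,n]). Then R(j·d) = (j+1)(j+2)/2 for every integer j with 0 ≤ j ≤ d−3. -/

import Mathlib

/-- Lattice points of the triangle `x, y ≥ 0`, `b² x + c² y ≤ j b c`. -/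
def trianglePoints (b c j : ℕ) : Finset (ℕ × ℕ) :=
  {p ∈ Finset.range (j * c + 1) ×ˢ Finset.range (j * b + 1) |
    b ^ 2 * p.1 + c ^ 2 * p.2 ≤ j * b * c}

/-- Lattice points in the interior of the triangle `x, y ≥ 0`, `b² x + c² y ≤ j b c`. -/
def triangleInterior (b c j : ℕ) : Finset (ℕ × ℕ) :=
  {p ∈ trianglePoints b c j | 1 ≤ p.1 ∧ 1 ≤ p.2 ∧ b ^ 2 * p.1 + c ^ 2 * p.2 < j * b * c}

theorem mem_trianglePoints {b c j : ℕ} (hb : 0 < b) (hc : 0 < c) (p : ℕ × ℕ) :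
    p ∈ trianglePoints b c j ↔ b ^ 2 * p.1 + c ^ 2 * p.2 ≤ j * b * c := by
  simp only [trianglePoints, Finset.mem_filter, Finset.mem_product, Finset.mem_range,
    and_iff_right_iff_imp]
  intro h
  constructor
  · have h1 : b * (b * p.1) ≤ b * (j * c) := by nlinarith [Nat.zero_le (c ^ 2 * p.2)]
    have h2 := Nat.le_of_mul_le_mul_left h1 hb
    nlinarith
  · have h1 : c * (c * p.2) ≤ c * (j * b) := by nlinarith [Nat.zero_le (b ^ 2 * p.1)]
    have h2 := Nat.le_of_mul_le_mul_left h1 hc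
    nlinarith

theorem mem_triangleInterior {b c j : ℕ} (hb : 0 < b) (hc : 0 < c) (p : ℕ × ℕ) :
    p ∈ triangleInterior b c j ↔
      1 ≤ p.1 ∧ 1 ≤ p.2 ∧ b ^ 2 * p.1 + c ^ 2 * p.2 < j * b * c := by
  rw [triangleInterior, Finset.mem_filter, mem_trianglePoints hb hc]
  constructor
  · exact fun h => h.2
  · exact fun h => ⟨h.2.2.le, h⟩

theorem coprime_of_markov {b c : ℕ} (h : b ^ 2 + c ^ 2 + 1 = 3 * b * c) : Nat.Coprime b c := by
  have h1 : Nat.gcd b c ∣ b ^ 2 + c ^ 2 :=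
    dvd_add (dvd_pow (Nat.gcd_dvd_left b c) two_ne_zero)
      (dvd_pow (Nat.gcd_dvd_right b c) two_ne_zero)
  have h2 : Nat.gcd b c ∣ b ^ 2 + c ^ 2 + 1 := by
    rw [h]; exact dvd_mul_of_dvd_right (Nat.gcd_dvd_right b c) _
  exact Nat.dvd_one.1 ((Nat.dvd_add_right h1).1 h2)

/-- On the line `b² x + c² y = j b c`, the lattice points are parametrized by one integer. -/
theorem exists_param_of_hypotenuse {b c j x y : ℕ} (hb : 0 < b) (hc : 0 < c)
    (h : b ^ 2 + c ^ 2 + 1 = 3 * b * c) (hxy : b ^ 2 * x + c ^ 2 * y = j * b * c) :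
    ∃ t : ℤ, (x : ℤ) = c * (3 * j * c - j * b - c * t) ∧ (y : ℤ) = b * (b * t - j * c) := by
  have hcop := coprime_of_markov h
  have hx : c ∣ x := by
    have h1 : c ∣ b ^ 2 * x := by
      refine (Nat.dvd_add_left (?_ : c ∣ c ^ 2 * y)).1 (hxy ▸ Dvd.intro_left _ rfl)
      exact dvd_mul_of_dvd_left (dvd_pow_self _ two_ne_zero) _
    exact ((hcop.symm).pow_right 2).dvd_of_dvd_mul_left h1
  have hy : b ∣ y := by
    have h1 : b ∣ c ^ 2 * y := by
      refine (Nat.dvd_add_right (?_ : b ∣ b ^ 2 * x)).1 (hxy ▸ ⟨j * c, by ring⟩)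
      exact dvd_mul_of_dvd_left (dvd_pow_self _ two_ne_zero) _
    exact (hcop.pow_right 2).dvd_of_dvd_mul_left h1
  obtain ⟨u, rfl⟩ := hx
  obtain ⟨v, rfl⟩ := hy
  have huv : b * u + c * v = j := by
    have : (b * c) * (b * u + c * v) = (b * c) * j := by linarith
    exact Nat.eq_of_mul_eq_mul_left (Nat.mul_pos hb hc) this
  have h' : (b : ℤ) ^ 2 + c ^ 2 + 1 = 3 * b * c := by exact_mod_cast h
  refine ⟨c * u + (3 * c - b) * v, ?_, ?_⟩
  · subst huv
    push_cast
    linear_combination (c : ℤ) * (u : ℤ) * h'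
  · subst huv
    push_cast
    linear_combination (b : ℤ) * (v : ℤ) * h'

theorem card_trianglePoints_eq_add_interior {b c j : ℕ} (hb : 0 < b) (hc : 0 < c)
    (h : b ^ 2 + c ^ 2 + 1 = 3 * b * c) (hj : 1 ≤ j) :
    (trianglePoints b c j).card = 3 * j + (triangleInterior b c j).card := by
  have hdb := Nat.div_add_mod (j * c) b
  have hdc := Nat.div_add_mod (j * b) c
  have hmb := Nat.mod_lt (j * c) hb
  have hmc := Nat.mod_lt (j * b) hc
  set f := j * c / b with hf
  set g := j * b / c with hg
  have hfg : f + g + 1 ≤ 3 * j := by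
    by_contra hcon
    have h1 : 3 * j ≤ f + g := by omega
    have h2 : (b * c) * (f + g) ≤ j * (b ^ 2 + c ^ 2) := by
      nlinarith [Nat.mul_le_mul_left c (Nat.le.intro hdb), Nat.mul_le_mul_left b (Nat.le.intro hdc)]
    have h3 := Nat.mul_le_mul_left (b * c) h1
    nlinarith
  have h' : (b : ℤ) ^ 2 + c ^ 2 + 1 = 3 * b * c := by exact_mod_cast h
  have hbz : (0 : ℤ) < b := by exact_mod_cast hb
  have hcz : (0 : ℤ) < c := by exact_mod_cast hc
  let A : Finset (ℕ × ℕ) := (Finset.range (g + 1)).image fun y => (0, y)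
  let B : Finset (ℕ × ℕ) := (Finset.range f).image fun x => (x + 1, 0)
  let H : Finset (ℕ × ℕ) := (trianglePoints b c j).filter fun p =>
    1 ≤ p.1 ∧ 1 ≤ p.2 ∧ b ^ 2 * p.1 + c ^ 2 * p.2 = j * b * c
  have hA : A.card = g + 1 := by
    rw [Finset.card_image_of_injective _ (fun x y hxy => by simpa using hxy), Finset.card_range]
  have hB : B.card = f := by
    rw [Finset.card_image_of_injective _ (fun x y hxy => by simpa using hxy), Finset.card_range]
  have hH : H.card + (f + g + 1) = 3 * j := by
    have hpos (t : ℤ) : t ∈ Finset.Ioo (f : ℤ) (3 * j - g) ↔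
        0 < 3 * (j : ℤ) * c - j * b - c * t ∧ 0 < (b : ℤ) * t - j * c := by
      zify at hdb hdc hmb hmc
      have hr : (0 : ℤ) ≤ (j * c : ℤ) % b := Int.emod_nonneg _ hbz.ne'
      have hs : (0 : ℤ) ≤ (j * b : ℤ) % c := Int.emod_nonneg _ hcz.ne'
      rw [Finset.mem_Ioo]
      constructor
      · rintro ⟨h1, h2⟩
        constructor
        · nlinarith [mul_le_mul_of_nonneg_left (Int.add_one_le_iff.2 h2) hcz.le]
        · nlinarith [mul_le_mul_of_nonneg_left (Int.add_one_le_iff.2 h1) hbz.le]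
      · rintro ⟨h1, h2⟩
        constructor
        · exact lt_of_mul_lt_mul_left (by linarith : (b : ℤ) * f < b * t) hbz.le
        · exact lt_of_mul_lt_mul_left (by linarith : (c : ℤ) * t < c * (3 * j - g)) hcz.le
    have : (Finset.Ioo (f : ℤ) (3 * j - g)).card = H.card := by
      refine Finset.card_bij
        (fun t _ => ((c * (3 * j * c - j * b - c * t) : ℤ).toNat,
          (b * (b * t - j * c) : ℤ).toNat)) ?_ ?_ ?_
      · intro t ht
        obtain ⟨hu, hv⟩ := (hpos t).1 ht
        generalize hu' : 3 * (j : ℤ) * c - j * b - c * t = u at *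
        generalize hv' : (b : ℤ) * t - j * c = v at *
        have hcu := mul_pos hcz hu
        have hbv := mul_pos hbz hv
        have heq : b ^ 2 * (c * u).toNat + c ^ 2 * (b * v).toNat = j * b * c := by
          zify
          rw [Int.toNat_of_nonneg hcu.le, Int.toNat_of_nonneg hbv.le, ← hu', ← hv']
          linear_combination (-(j * b * c) : ℤ) * h'
        refine Finset.mem_filter.2 ⟨(mem_trianglePoints hb hc _).2 heq.le, ?_, ?_, heq⟩
        · simpa [Nat.one_le_iff_ne_zero] using hcu
        · simpa [Nat.one_le_iff_ne_zero] using hbv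
      · intro t ht t' ht' he
        have hv := mul_pos hbz ((hpos t).1 ht).2
        have hv' := mul_pos hbz ((hpos t').1 ht').2
        have h1 := (Prod.mk.inj he).2
        have h2 : (b : ℤ) * (b * t - j * c) = b * (b * t' - j * c) := by omega
        have h3 := mul_left_cancel₀ hbz.ne' h2
        exact mul_left_cancel₀ hbz.ne' (by linarith : (b : ℤ) * t = b * t')
      · rintro ⟨x, y⟩ hp
        obtain ⟨-, hx, hy, he⟩ := Finset.mem_filter.1 hp
        obtain ⟨t, htx, hty⟩ := exists_param_of_hypotenuse hb hc h he
        have hx' : (0 : ℤ) < x := by exact_mod_cast hx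
        have hy' : (0 : ℤ) < y := by exact_mod_cast hy
        refine ⟨t, (hpos t).2 ⟨pos_of_mul_pos_right (htx ▸ hx') hcz.le,
          pos_of_mul_pos_right (hty ▸ hy') hbz.le⟩, ?_⟩
        rw [← htx, ← hty, Int.toNat_natCast, Int.toNat_natCast]
    rw [← this, Int.card_Ioo]
    omega
  have hun : trianglePoints b c j = A ∪ (B ∪ (H ∪ triangleInterior b c j)) := by
    ext ⟨x, y⟩
    simp only [A, B, H, Finset.mem_union, Finset.mem_image, Finset.mem_filter, Finset.mem_range,
      mem_trianglePoints hb hc, mem_triangleInterior hb hc, Prod.mk.injEq]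
    have hy0 : c ^ 2 * y ≤ j * b * c ↔ y < g + 1 := by
      rw [Nat.lt_succ_iff, hg, Nat.le_div_iff_mul_le hc]
      constructor
      · intro h1
        exact Nat.le_of_mul_le_mul_left (by linarith : c * (y * c) ≤ c * (j * b)) hc
      · intro h1
        linarith [Nat.mul_le_mul_left c h1]
    have hx0 : b ^ 2 * x ≤ j * b * c ↔ x ≤ f := by
      rw [hf, Nat.le_div_iff_mul_le hb]
      constructor
      · intro h1
        exact Nat.le_of_mul_le_mul_left (by linarith : b * (x * b) ≤ b * (j * c)) hb
      · intro h1
        linarith [Nat.mul_le_mul_left b h1]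
    constructor
    · intro hle
      rcases Nat.eq_zero_or_pos x with rfl | hx
      · exact Or.inl ⟨y, hy0.1 (by simpa using hle), rfl, rfl⟩
      rcases Nat.eq_zero_or_pos y with rfl | hy
      · have := hx0.1 (by simpa using hle)
        exact Or.inr (Or.inl ⟨x - 1, by omega, by omega, rfl⟩)
      rcases hle.eq_or_lt with he | hlt
      · exact Or.inr (Or.inr (Or.inl ⟨hle, hx, hy, he⟩))
      · exact Or.inr (Or.inr (Or.inr ⟨hx, hy, hlt⟩))
    · rintro (⟨y', hy', rfl, rfl⟩ | ⟨x', hx', rfl, rfl⟩ | hh | hh)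
      · simpa using hy0.2 hy'
      · simpa using hx0.2 (by omega)
      · exact hh.1
      · exact hh.2.2.le
  have d3 : Disjoint H (triangleInterior b c j) := by
    rw [Finset.disjoint_left]
    intro p hp hq
    have h1 := (Finset.mem_filter.1 hp).2.2.2
    have h2 := ((mem_triangleInterior hb hc p).1 hq).2.2
    omega
  have d2 : Disjoint B (H ∪ triangleInterior b c j) := by
    rw [Finset.disjoint_left]
    intro p hp hq
    obtain ⟨x, -, rfl⟩ := Finset.mem_image.1 hp
    rcases Finset.mem_union.1 hq with hq | hq
    · have h1 := (Finset.mem_filter.1 hq).2.2.1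
      simp at h1
    · have h1 := ((mem_triangleInterior hb hc _).1 hq).2.1
      simp at h1
  have d1 : Disjoint A (B ∪ (H ∪ triangleInterior b c j)) := by
    rw [Finset.disjoint_left]
    intro p hp hq
    obtain ⟨y, -, rfl⟩ := Finset.mem_image.1 hp
    rcases Finset.mem_union.1 hq with hq | hq
    · obtain ⟨x, -, hx⟩ := Finset.mem_image.1 hq
      simp at hx
    rcases Finset.mem_union.1 hq with hq | hq
    · have h1 := (Finset.mem_filter.1 hq).2.1
      simp at h1
    · have h1 := ((mem_triangleInterior hb hc _).1 hq).1
      simp at h1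
  rw [hun, Finset.card_union_of_disjoint d1, Finset.card_union_of_disjoint d2,
    Finset.card_union_of_disjoint d3, hA, hB]
  omega

theorem card_triangleInterior_add_three {b c : ℕ} (hb : 0 < b) (hc : 0 < c)
    (h : b ^ 2 + c ^ 2 + 1 = 3 * b * c) (j : ℕ) :
    (triangleInterior b c (j + 3)).card = (trianglePoints b c j).card := by
  have : triangleInterior b c (j + 3) =
      (trianglePoints b c j).image fun p => (p.1 + 1, p.2 + 1) := by
    ext ⟨x, y⟩
    simp only [Finset.mem_image, mem_trianglePoints hb hc, mem_triangleInterior hb hc, Prod.exists,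
      Prod.mk.injEq]
    constructor
    · rintro ⟨hx, hy, hlt⟩
      obtain ⟨x, rfl⟩ := Nat.exists_eq_add_of_le' hx
      obtain ⟨y, rfl⟩ := Nat.exists_eq_add_of_le' hy
      exact ⟨x, y, by nlinarith, rfl, rfl⟩
    · rintro ⟨x, y, hle, rfl, rfl⟩
      exact ⟨by omega, by omega, by nlinarith⟩
  rw [this, Finset.card_image_of_injective]
  intro p q hpq
  simpa [Prod.ext_iff] using hpq

theorem triangleInterior_eq_empty {b c j : ℕ} (hb : 0 < b) (hc : 0 < c)
    (h : b ^ 2 + c ^ 2 + 1 = 3 * b * c) (hj : j ≤ 2) : triangleInterior b c j = ∅ := by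
  rw [Finset.eq_empty_iff_forall_notMem]
  intro p hp
  obtain ⟨hx, hy, hlt⟩ := (mem_triangleInterior hb hc p).1 hp
  have h1 := Nat.mul_le_mul_left (b ^ 2) hx
  have h2 := Nat.mul_le_mul_left (c ^ 2) hy
  have h3 := Nat.mul_le_mul_right (b * c) hj
  have h4 := Nat.mul_pos hb hc
  nlinarith

/-- Period collapse: the triangle attached to a Markov triple `(1, b, c)` has the same Ehrhart
function as the standard triangle. -/
theorem card_trianglePoints {b c : ℕ} (hb : 0 < b) (hc : 0 < c)
    (h : b ^ 2 + c ^ 2 + 1 = 3 * b * c) (j : ℕ) :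
    2 * (trianglePoints b c j).card = (j + 1) * (j + 2) := by
  induction j using Nat.strong_induction_on with
  | _ j ih =>
    match j, ih with
    | 0, _ => simp [trianglePoints, Finset.filter_singleton]
    | 1, _ =>
      rw [card_trianglePoints_eq_add_interior hb hc h le_rfl,
        triangleInterior_eq_empty hb hc h (by norm_num)]
      rfl
    | 2, _ =>
      rw [card_trianglePoints_eq_add_interior hb hc h (by norm_num),
        triangleInterior_eq_empty hb hc h (by norm_num)]
      rfl
    | j + 3, ih =>
      rw [card_trianglePoints_eq_add_interior hb hc h (by omega),
        card_triangleInterior_add_three hb hc h, mul_add, ih j (by omega)]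
      ring

/-- The parametrization `(x, Y) ↦ x g₀ + (Y mod p₁) g₁ + ⌊Y / p₁⌋ g₂` of the semigroup. -/
def semigroupElement (p1 q1 p2 g2 : ℕ) (p : ℕ × ℕ) : ℕ :=
  p.1 * (p1 * p2) + (p.2 % p1) * (q1 * p2) + (p.2 / p1) * g2

theorem semigroupElement_mem (p1 q1 p2 g2 : ℕ) (p : ℕ × ℕ) :
    semigroupElement p1 q1 p2 g2 p ∈
      AddSubmonoid.closure ({p1 * p2, q1 * p2, g2} : Set ℕ) := by
  have h (n g : ℕ) (hg : g ∈ ({p1 * p2, q1 * p2, g2} : Set ℕ)) :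
      n * g ∈ AddSubmonoid.closure ({p1 * p2, q1 * p2, g2} : Set ℕ) := by
    rw [← smul_eq_mul]
    exact AddSubmonoid.nsmul_mem _ (AddSubmonoid.subset_closure hg) n
  exact add_mem (add_mem (h _ _ (by simp)) (h _ _ (by simp))) (h _ _ (by simp))

theorem exists_semigroupElement_eq {p1 q1 p2 g2 m : ℕ} (hp1 : 0 < p1)
    (hm : m ∈ AddSubmonoid.closure ({p1 * p2, q1 * p2, g2} : Set ℕ)) :
    ∃ p, semigroupElement p1 q1 p2 g2 p = m := by
  have : ∃ α β γ : ℕ, m = α * (p1 * p2) + β * (q1 * p2) + γ * g2 := by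
    induction hm using AddSubmonoid.closure_induction with
    | mem x hx =>
      rcases hx with rfl | rfl | rfl
      · exact ⟨1, 0, 0, by ring⟩
      · exact ⟨0, 1, 0, by ring⟩
      · exact ⟨0, 0, 1, by ring⟩
    | zero => exact ⟨0, 0, 0, by ring⟩
    | add x y _ _ hx hy =>
      obtain ⟨α, β, γ, rfl⟩ := hx
      obtain ⟨α', β', γ', rfl⟩ := hy
      exact ⟨α + α', β + β', γ + γ', by ring⟩
  obtain ⟨α, β, γ, rfl⟩ := this
  refine ⟨(α + q1 * (β / p1), p1 * γ + β % p1), ?_⟩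
  have hlt := Nat.mod_lt β hp1
  have h1 : (p1 * γ + β % p1) % p1 = β % p1 := by
    rw [Nat.mul_add_mod, Nat.mod_mod]
  have h2 : (p1 * γ + β % p1) / p1 = γ := by
    rw [Nat.mul_add_div hp1, Nat.div_eq_of_lt hlt, add_zero]
  simp only [semigroupElement, h1, h2]
  conv_rhs => rw [← Nat.div_add_mod β p1]
  ring

theorem semigroupElement_injOn {p1 q1 p2 g2 : ℕ} (hp1 : 0 < p1) (hp2 : 0 < p2)
    (h1 : Nat.Coprime p1 q1) (h2 : Nat.Coprime p2 g2) :
    Set.InjOn (semigroupElement p1 q1 p2 g2) {p | p.2 < p1 * p2} := by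
  rintro ⟨x, y⟩ hy ⟨x', y'⟩ hy' he
  simp only [semigroupElement, Set.mem_ofPred_eq] at hy hy' he
  have hi : y / p1 = y' / p1 := by
    have hmod : (y / p1) * g2 ≡ (y' / p1) * g2 [MOD p2] := by
      have e1 : (x * p1 + (y % p1) * q1) * p2 + (y / p1) * g2 =
          (x' * p1 + (y' % p1) * q1) * p2 + (y' / p1) * g2 := by linarith
      have e2 := congrArg (· % p2) e1
      simpa [Nat.ModEq, Nat.mul_add_mod'] using e2
    have hmod' := Nat.ModEq.cancel_right_of_coprime h2 hmod
    exact hmod'.eq_of_lt_of_lt (Nat.div_lt_of_lt_mul hy) (Nat.div_lt_of_lt_mul hy')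
  rw [hi] at he
  have he' : x * p1 + (y % p1) * q1 = x' * p1 + (y' % p1) * q1 := by
    refine Nat.eq_of_mul_eq_mul_right hp2 ?_
    linarith
  have hr : y % p1 = y' % p1 := by
    have hmod : (y % p1) * q1 ≡ (y' % p1) * q1 [MOD p1] := by
      have e2 := congrArg (· % p1) he'
      simpa [Nat.ModEq, Nat.mul_add_mod'] using e2
    exact (Nat.ModEq.cancel_right_of_coprime h1 hmod).eq_of_lt_of_lt
      (Nat.mod_lt _ hp1) (Nat.mod_lt _ hp1)
  rw [hr] at he'
  have hx : x = x' := Nat.eq_of_mul_eq_mul_right hp1 (by linarith)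
  have hyy : y = y' := by rw [← Nat.div_add_mod y p1, ← Nat.div_add_mod y' p1, hi, hr]
  rw [hx, hyy]

theorem semigroupElement_le_iff {p1 q1 b c g2 q2 j : ℕ} (hp1 : 0 < p1) (hb : 0 < b)
    (hc : 0 < c) (h : b ^ 2 + c ^ 2 + 1 = 3 * b * c) (hq1 : c ^ 2 * p1 = b ^ 2 * q1 + 1)
    (hg2 : b * g2 = (c * p1) ^ 2 + 1) (hq2 : b * q2 = p1 + 1) {p : ℕ × ℕ}
    (hp : p.2 < p1 * b) :
    semigroupElement p1 q1 b g2 p ≤ j * (c * p1) ↔ b ^ 2 * p.1 + c ^ 2 * p.2 ≤ j * b * c := by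
  obtain ⟨x, y⟩ := p
  simp only [semigroupElement] at hp ⊢
  have hdm := Nat.div_add_mod y p1
  have hr := Nat.mod_lt y hp1
  have hi : y / p1 < b := Nat.div_lt_of_lt_mul hp
  generalize y / p1 = i at *
  generalize y % p1 = r at *
  have hbz : (0 : ℤ) < b := by exact_mod_cast hb
  have hpz : (0 : ℤ) < p1 := by exact_mod_cast hp1
  have hrz : (r : ℤ) < p1 := by exact_mod_cast hr
  have hiz : (i : ℤ) < b := by exact_mod_cast hi
  have hr0 : (0 : ℤ) ≤ r := Int.natCast_nonneg r
  have hi0 : (0 : ℤ) ≤ i := Int.natCast_nonneg i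
  have hbp : (b : ℤ) ≤ p1 + 1 := by
    exact_mod_cast Nat.le_of_dvd (Nat.succ_pos _) (Dvd.intro _ hq2)
  zify at h hq1 hg2 hq2 hdm ⊢
  obtain ⟨M, hM⟩ : ∃ M : ℤ, M = b ^ 2 * x + c ^ 2 * y - j * b * c := ⟨_, rfl⟩
  have key : (b : ℤ) * (x * (p1 * b) + r * (q1 * b) + i * g2 - j * (c * p1)) =
      p1 * M + i - r := by
    rw [hM]
    linear_combination (i : ℤ) * hg2 - (r : ℤ) * hq1 + (p1 * c ^ 2 : ℤ) * hdm
  have hM' : (b : ℤ) ^ 2 * x + c ^ 2 * y ≤ j * b * c ↔ M ≤ 0 := by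
    rw [hM]; constructor <;> intro _ <;> linarith
  have hL : (x * (p1 * b) + r * (q1 * b) + i * g2 : ℤ) ≤ j * (c * p1) ↔
      (p1 : ℤ) * M + i - r ≤ 0 := by
    rw [← key, ← sub_nonpos]
    constructor
    · intro _; nlinarith
    · intro h1; by_contra h2; nlinarith [mul_pos hbz (not_le.1 h2)]
  rw [hM', hL]
  constructor
  · intro h1
    by_contra h2
    have : (1 : ℤ) ≤ M := by omega
    nlinarith
  · intro h1
    rcases h1.eq_or_lt with h0 | hneg
    · have hyb : (b : ℤ) ∣ y := by
        obtain ⟨t, -, ht⟩ := exists_param_of_hypotenuse (x := x) (y := y) (j := j) hb hc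
          (by exact_mod_cast h) (by zify; linarith)
        exact ⟨_, ht⟩
      obtain ⟨v, hv⟩ := hyb
      have hdvd : (b : ℤ) ∣ i - r := ⟨q2 * i - v, by linear_combination (-i : ℤ) * hq2 - hdm - hv⟩
      rw [h0]
      by_contra hlt
      have := Int.le_of_dvd (by linarith) hdvd
      linarith
    · nlinarith

theorem fib_odd_cassini (n : ℕ) :
    Nat.fib (2 * n + 1) ^ 2 + Nat.fib (2 * n + 1) * Nat.fib (2 * n + 2) =
      Nat.fib (2 * n + 2) ^ 2 + 1 := by
  induction n with
  | zero => decide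
  | succ n ih =>
    have h1 : Nat.fib (2 * n + 3) = Nat.fib (2 * n + 1) + Nat.fib (2 * n + 2) := Nat.fib_add_two
    have h2 : Nat.fib (2 * n + 4) = Nat.fib (2 * n + 2) + Nat.fib (2 * n + 3) := Nat.fib_add_two
    rw [show 2 * (n + 1) + 1 = 2 * n + 3 by ring, show 2 * (n + 1) + 2 = 2 * n + 4 by ring, h2, h1]
    nlinarith

/-- The semigroup `⟨p₁ b, q₁ b, g₂⟩` has as many elements up to `j c p₁` as the triangle
`b² x + c² y ≤ j b c` has lattice points. -/
theorem ncard_semigroup_le {p1 q1 b c g2 q2 j : ℕ} (hp1 : 0 < p1) (hb : 0 < b)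
    (hc : 0 < c) (h : b ^ 2 + c ^ 2 + 1 = 3 * b * c) (hq1 : c ^ 2 * p1 = b ^ 2 * q1 + 1)
    (hg2 : b * g2 = (c * p1) ^ 2 + 1) (hq2 : b * q2 = p1 + 1) (hcop : Nat.Coprime b g2)
    (hj : j < c * p1) :
    {m : ℕ | m ∈ AddSubmonoid.closure ({p1 * b, q1 * b, g2} : Set ℕ) ∧
        m ≤ j * (c * p1)}.ncard = (trianglePoints b c j).card := by
  have hcop' : Nat.Coprime p1 q1 := by
    have h1 : Nat.gcd p1 q1 ∣ b ^ 2 * q1 + 1 :=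
      hq1 ▸ dvd_mul_of_dvd_right (Nat.gcd_dvd_left p1 q1) _
    exact Nat.dvd_one.1
      ((Nat.dvd_add_right (dvd_mul_of_dvd_right (Nat.gcd_dvd_right p1 q1) _)).1 h1)
  have hbound : ∀ p ∈ trianglePoints b c j, p.2 < p1 * b := by
    intro p hp
    rw [mem_trianglePoints hb hc] at hp
    have h1 : c * (c * p.2) ≤ c * (j * b) := by nlinarith [Nat.zero_le (b ^ 2 * p.1)]
    have h2 := Nat.le_of_mul_le_mul_left h1 hc
    have h3 : c * p.2 < c * (p1 * b) := by nlinarith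
    exact Nat.lt_of_mul_lt_mul_left h3
  have himage : {m : ℕ | m ∈ AddSubmonoid.closure ({p1 * b, q1 * b, g2} : Set ℕ) ∧
      m ≤ j * (c * p1)} =
      (semigroupElement p1 q1 b g2) '' (trianglePoints b c j : Set (ℕ × ℕ)) := by
    ext m
    simp only [Set.mem_ofPred_eq, Set.mem_image, Finset.mem_coe]
    constructor
    · rintro ⟨hm, hle⟩
      obtain ⟨p, rfl⟩ := exists_semigroupElement_eq hp1 hm
      have hp : p.2 < p1 * b := by
        rw [mul_comm, ← Nat.div_lt_iff_lt_mul hp1]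
        by_contra hge
        have h1 : b * g2 ≤ j * (c * p1) :=
          (Nat.mul_le_mul_right g2 (not_lt.1 hge)).trans ((Nat.le_add_left _ _).trans hle)
        nlinarith
      exact ⟨p, (mem_trianglePoints hb hc p).2
        ((semigroupElement_le_iff hp1 hb hc h hq1 hg2 hq2 hp).1 hle), rfl⟩
    · rintro ⟨p, hp, rfl⟩
      exact ⟨semigroupElement_mem p1 q1 b g2 p, (semigroupElement_le_iff hp1 hb hc h hq1 hg2 hq2
        (hbound p hp)).2 ((mem_trianglePoints hb hc p).1 hp)⟩
  rw [himage, ((semigroupElement_injOn hp1 hb hcop' hcop).mono hbound).ncard_image,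
    Set.ncard_coe_finset]

/-- Family (ii) of the classification: for `k ≥ 3`, `l ≥ 0`, the singularity type
`(p1,q1)(p2,q2)` with `p1 = l·F(2k−1)² + F(2k−3)²`, `q1 = l·F(2k+1)² + F(2k−1)² + 2`,
`p2 = F(2k−1)`, `q2 = l·F(2k−1) + F(2k−5)`, and `d = F(2k+1)·p1` satisfies the
Borodzik–Livingston counting condition `R(j·d) = (j+1)(j+2)/2` for `0 ≤ j ≤ d−3`. -/
theorem counting_condition_family_ii
    (k l p1 q1 p2 q2 d : ℕ) (hk : 3 ≤ k)
    (hp1 : p1 = l * (Nat.fib (2 * k - 1)) ^ 2 + (Nat.fib (2 * k - 3)) ^ 2)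
    (hq1 : q1 = l * (Nat.fib (2 * k + 1)) ^ 2 + (Nat.fib (2 * k - 1)) ^ 2 + 2)
    (hp2 : p2 = Nat.fib (2 * k - 1))
    (hq2 : q2 = l * Nat.fib (2 * k - 1) + Nat.fib (2 * k - 5))
    (hd : d = Nat.fib (2 * k + 1) * p1) :
    ∀ j : ℕ, j ≤ d - 3 →
      {m : ℕ | m ∈ AddSubmonoid.closure ({p1 * p2, q1 * p2, p1 * p2 * q1 + q2} : Set ℕ) ∧
        m ≤ j * d}.ncard = (j + 1) * (j + 2) / 2 := by

  intro j hj
  obtain ⟨n, rfl⟩ := Nat.exists_eq_add_of_le' hk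
  rw [show 2 * (n + 3) - 1 = 2 * n + 5 by omega] at *
  rw [show 2 * (n + 3) + 1 = 2 * n + 7 by omega] at *
  rw [show 2 * (n + 3) - 3 = 2 * n + 3 by omega] at *
  rw [show 2 * (n + 3) - 5 = 2 * n + 1 by omega] at *
  have f3 : Nat.fib (2 * n + 3) = Nat.fib (2 * n + 1) + Nat.fib (2 * n + 2) := Nat.fib_add_two
  have f4 : Nat.fib (2 * n + 4) = Nat.fib (2 * n + 2) + Nat.fib (2 * n + 3) := Nat.fib_add_two
  have f5 : Nat.fib (2 * n + 5) = Nat.fib (2 * n + 3) + Nat.fib (2 * n + 4) := Nat.fib_add_two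
  have f6 : Nat.fib (2 * n + 6) = Nat.fib (2 * n + 4) + Nat.fib (2 * n + 5) := Nat.fib_add_two
  have f7 : Nat.fib (2 * n + 7) = Nat.fib (2 * n + 5) + Nat.fib (2 * n + 6) := Nat.fib_add_two
  have hcas := fib_odd_cassini n
  have hbe : Nat.Coprime (Nat.fib (2 * n + 5)) (Nat.fib (2 * n + 1)) := by
    have : Nat.gcd (2 * n + 5) (2 * n + 1) = 1 := by
      rw [show 2 * n + 5 = 2 ^ 2 + (2 * n + 1) by ring, Nat.gcd_add_self_left]
      exact Nat.Coprime.pow_left 2 (by simp)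
    rw [Nat.Coprime, ← Nat.fib_gcd, this, Nat.fib_one]
  have hepos : 0 < Nat.fib (2 * n + 1) := Nat.fib_pos.2 (by omega)
  generalize Nat.fib (2 * n + 1) = e at *
  generalize Nat.fib (2 * n + 2) = f at *
  generalize Nat.fib (2 * n + 3) = a at *
  generalize Nat.fib (2 * n + 5) = b at *
  generalize Nat.fib (2 * n + 7) = c at *
  have hb : b = 2 * e + 3 * f := by omega
  have hc : c = 5 * e + 8 * f := by omega
  clear f4 f5 f6 f7
  have hmarkov : b ^ 2 + c ^ 2 + 1 = 3 * b * c := by rw [hb, hc]; linear_combination -hcas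
  have hac : a * c = b ^ 2 + 1 := by rw [f3, hb, hc]; linear_combination hcas
  have hbea : b * e = a ^ 2 + 1 := by rw [f3, hb]; linear_combination hcas
  have hbq2 : b * q2 = p1 + 1 := by rw [hq2, hp1, mul_add, hbea]; ring
  have hcq1 : c ^ 2 * p1 = b ^ 2 * q1 + 1 := by
    rw [hp1, hq1]
    zify at hac ⊢
    linear_combination (a * c + b ^ 2 + 1 : ℤ) * hac
  have hp1pos : 0 < p1 := by
    rw [hp1]
    have : 0 < a ^ 2 := pow_pos (by omega) 2
    omega
  have hg2 : b * (p1 * p2 * q1 + q2) = (c * p1) ^ 2 + 1 := by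
    rw [hp2]
    zify at hcq1 hbq2 ⊢
    linear_combination hbq2 - (p1 : ℤ) * hcq1
  have hcop : Nat.Coprime b (p1 * p2 * q1 + q2) := by
    rw [hp2, hq2, show p1 * b * q1 + (l * b + e) = e + b * (p1 * q1 + l) by ring]
    simpa using hbe
  have hjd : j < c * p1 := by
    have : 0 < c * p1 := Nat.mul_pos (by omega) hp1pos
    omega
  subst hp2 hd
  rw [ncard_semigroup_le hp1pos (by omega) (by omega) hmarkov hcq1 hg2 hbq2 hcop hjd,
    ← card_trianglePoints (by omega) (by omega) hmarkov j]
  omega
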